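/- Let (0, 0, h) be a map of triangles from a distinguished triangle X →u Y →v Z →w ΣX to a distinguished triangle X' →u' Y' →v' Z' →w' ΣX' whose first two components are zero (so h∘v = 0 and w'∘h = 0). Then the following are equivalent: (a) (0,0,h) is good; (b) (0,0,h) is Verdier good; (c) (0,0,h) is middling good; (d) there exists φ: ΣX→Z' with φ∘w = h and w'∘φ = 0 (i.e., the Toda bracket ⟨w', h, v⟩ contains zero); (e) h is a lightning flash, i.e., h = v'∘θ∘w for some θ: ΣX→Y'. -/

import Mathlib

open CategoryTheory Category Limits Pretriangulated

universe v u

variable {C : Type u} [Category.{v} C] [Preadditive C] [HasZeroObject C]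
  [HasShift C ℤ] [∀ n : ℤ, (shiftFunctor C n).Additive] [Pretriangulated C]
  [IsTriangulated C] [HasBinaryBiproducts C]

noncomputable local instance (n : ℤ) : PreservesBinaryBiproducts (shiftFunctor C n) :=
  preservesBinaryBiproducts_of_preservesBiproducts _

/-- The condition that `(f, g, h)` is a morphism of triangles from `T` to `T'`. -/
def IsTriMap (T T' : Triangle C) (f : T.obj₁ ⟶ T'.obj₁) (g : T.obj₂ ⟶ T'.obj₂)
    (h : T.obj₃ ⟶ T'.obj₃) : Prop :=
  T.mor₁ ≫ g = f ≫ T'.mor₁ ∧ T.mor₂ ≫ h = g ≫ T'.mor₂ ∧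
    T.mor₃ ≫ f⟦(1 : ℤ)⟧' = h ≫ T'.mor₃

/-- The mapping cone of a morphism of triangles. -/
noncomputable def mappingCone (T T' : Triangle C) (f : T.obj₁ ⟶ T'.obj₁)
    (g : T.obj₂ ⟶ T'.obj₂) (h : T.obj₃ ⟶ T'.obj₃) : Triangle C :=
  Triangle.mk
    (biprod.desc (biprod.lift T'.mor₁ 0) (biprod.lift g (-T.mor₂)) :
      T'.obj₁ ⊞ T.obj₂ ⟶ T'.obj₂ ⊞ T.obj₃)
    (biprod.desc (biprod.lift T'.mor₂ 0) (biprod.lift h (-T.mor₃)) :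
      T'.obj₂ ⊞ T.obj₃ ⟶ T'.obj₃ ⊞ T.obj₁⟦(1 : ℤ)⟧)
    (biprod.desc (biprod.lift T'.mor₃ 0)
        (biprod.lift (f⟦(1 : ℤ)⟧') (-(T.mor₁⟦(1 : ℤ)⟧'))) ≫
      ((shiftFunctor C (1 : ℤ)).mapBiprod T'.obj₁ T.obj₂).inv)

/-- A morphism of triangles is good if its mapping cone is distinguished. -/
noncomputable def IsGood (T T' : Triangle C) (f : T.obj₁ ⟶ T'.obj₁)
    (g : T.obj₂ ⟶ T'.obj₂) (h : T.obj₃ ⟶ T'.obj₃) : Prop :=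
  mappingCone T T' f g h ∈ distTriang C

/-- An octahedron on composable maps `a`, `b`, given distinguished triangles
`(a, p₁, q₁)`, `(b, p₂, q₂)` and `(a ≫ b, p₃, q₃)`, is a pair `(m, n)` as below. -/
def IsOctahedron {A₁ A₂ A₃ B₁ B₂ B₃ : C} (a : A₁ ⟶ A₂) (b : A₂ ⟶ A₃)
    (p₁ : A₂ ⟶ B₁) (q₁ : B₁ ⟶ A₁⟦(1 : ℤ)⟧)
    (p₂ : A₃ ⟶ B₂) (q₂ : B₂ ⟶ A₂⟦(1 : ℤ)⟧)
    (p₃ : A₃ ⟶ B₃) (q₃ : B₃ ⟶ A₁⟦(1 : ℤ)⟧)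
    (m : B₁ ⟶ B₃) (n : B₃ ⟶ B₂) : Prop :=
  p₁ ≫ m = b ≫ p₃ ∧ m ≫ q₃ = q₁ ∧ p₃ ≫ n = p₂ ∧ n ≫ q₂ = q₃ ≫ a⟦(1 : ℤ)⟧' ∧
    (Triangle.mk m n (q₂ ≫ p₁⟦(1 : ℤ)⟧') ∈ distTriang C)

/-- A morphism of triangles `(f, g, h)` is Verdier good if `h` arises from Verdier's
construction via two octahedra on the composite `g ∘ u = u' ∘ f`. -/
def IsVerdierGood (T T' : Triangle C) (f : T.obj₁ ⟶ T'.obj₁) (g : T.obj₂ ⟶ T'.obj₂)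
    (h : T.obj₃ ⟶ T'.obj₃) : Prop :=
  ∃ (A Y'' X'' : C) (vt : T'.obj₂ ⟶ A) (wt : A ⟶ T.obj₁⟦(1 : ℤ)⟧)
    (g' : T'.obj₂ ⟶ Y'') (g'' : Y'' ⟶ T.obj₂⟦(1 : ℤ)⟧)
    (f' : T'.obj₁ ⟶ X'') (f'' : X'' ⟶ T.obj₁⟦(1 : ℤ)⟧)
    (α₁ : T.obj₃ ⟶ A) (β₁ : A ⟶ Y'') (α₂ : X'' ⟶ A) (β₂ : A ⟶ T'.obj₃),
    (Triangle.mk (T.mor₁ ≫ g) vt wt ∈ distTriang C) ∧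
    (Triangle.mk g g' g'' ∈ distTriang C) ∧
    (Triangle.mk f f' f'' ∈ distTriang C) ∧
    IsOctahedron T.mor₁ g T.mor₂ T.mor₃ g' g'' vt wt α₁ β₁ ∧
    IsOctahedron f T'.mor₁ f' f'' T'.mor₂ T'.mor₃ vt wt α₂ β₂ ∧
    h = α₁ ≫ β₂

/-- The morphism of triangles `(f, g, h)` is nullhomotopic, in the (equivalent)
`Σ`-applied formulation of the first equation. -/
def IsNullHomotopic (T T' : Triangle C) (f : T.obj₁ ⟶ T'.obj₁) (g : T.obj₂ ⟶ T'.obj₂)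
    (h : T.obj₃ ⟶ T'.obj₃) : Prop :=
  ∃ (F : T.obj₂ ⟶ T'.obj₁) (G : T.obj₃ ⟶ T'.obj₂) (H : T.obj₁⟦(1 : ℤ)⟧ ⟶ T'.obj₃),
    f⟦(1 : ℤ)⟧' = T.mor₁⟦(1 : ℤ)⟧' ≫ F⟦(1 : ℤ)⟧' + H ≫ T'.mor₃ ∧
    g = T.mor₂ ≫ G + F ≫ T'.mor₁ ∧
    h = T.mor₃ ≫ H + G ≫ T'.mor₂

/-- A triangle is contractible if its identity morphism is nullhomotopic. -/
def IsContractible (T : Triangle C) : Prop :=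
  IsNullHomotopic T T (𝟙 T.obj₁) (𝟙 T.obj₂) (𝟙 T.obj₃)

/-- A morphism of triangles is middling good if it extends to a 4 × 4 diagram. -/
def IsMiddlingGood (T T' : Triangle C) (f : T.obj₁ ⟶ T'.obj₁) (g : T.obj₂ ⟶ T'.obj₂)
    (h : T.obj₃ ⟶ T'.obj₃) : Prop :=
  ∃ (X'' Y'' Z'' : C)
    (f' : T'.obj₁ ⟶ X'') (f'' : X'' ⟶ T.obj₁⟦(1 : ℤ)⟧)
    (g' : T'.obj₂ ⟶ Y'') (g'' : Y'' ⟶ T.obj₂⟦(1 : ℤ)⟧)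
    (h' : T'.obj₃ ⟶ Z'') (h'' : Z'' ⟶ T.obj₃⟦(1 : ℤ)⟧)
    (u'' : X'' ⟶ Y'') (v'' : Y'' ⟶ Z'') (w'' : Z'' ⟶ X''⟦(1 : ℤ)⟧),
    (Triangle.mk f f' f'' ∈ distTriang C) ∧
    (Triangle.mk g g' g'' ∈ distTriang C) ∧
    (Triangle.mk h h' h'' ∈ distTriang C) ∧
    (Triangle.mk u'' v'' w'' ∈ distTriang C) ∧
    T'.mor₁ ≫ g' = f' ≫ u'' ∧
    T'.mor₂ ≫ h' = g' ≫ v'' ∧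
    T'.mor₃ ≫ f'⟦(1 : ℤ)⟧' = h' ≫ w'' ∧
    u'' ≫ g'' = f'' ≫ T.mor₁⟦(1 : ℤ)⟧' ∧
    v'' ≫ h'' = g'' ≫ T.mor₂⟦(1 : ℤ)⟧' ∧
    h'' ≫ T.mor₃⟦(1 : ℤ)⟧' = -(w'' ≫ f''⟦(1 : ℤ)⟧')

/-- A candidate triangle `(a, b, c)` is replaceably exact if each of its three maps
can be replaced to give a distinguished triangle. -/
def ReplaceablyExact {A B D : C} (a : A ⟶ B) (b : B ⟶ D) (c : D ⟶ A⟦(1 : ℤ)⟧) : Prop :=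
  (∃ a' : A ⟶ B, Triangle.mk a' b c ∈ distTriang C) ∧
  (∃ b' : B ⟶ D, Triangle.mk a b' c ∈ distTriang C) ∧
  (∃ c' : D ⟶ A⟦(1 : ℤ)⟧, Triangle.mk a b c' ∈ distTriang C)

set_option linter.unusedSectionVars false

section MkForms

variable {A B D A' B' D' : C} {a : A ⟶ B} {b : B ⟶ D} {c : D ⟶ A⟦(1 : ℤ)⟧}
  {a' : A' ⟶ B'} {b' : B' ⟶ D'} {c' : D' ⟶ A'⟦(1 : ℤ)⟧}

lemma mk_distinguished_of_iso (hT : Triangle.mk a b c ∈ distTriang C) (e₁ : A' ≅ A) (e₂ : B' ≅ B)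
    (e₃ : D' ≅ D) (h₁ : a' ≫ e₂.hom = e₁.hom ≫ a) (h₂ : b' ≫ e₃.hom = e₂.hom ≫ b)
    (h₃ : c' ≫ e₁.hom⟦(1 : ℤ)⟧' = e₃.hom ≫ c) : Triangle.mk a' b' c' ∈ distTriang C :=
  isomorphic_distinguished _ hT _ (Triangle.isoMk _ _ e₁ e₂ e₃ h₁ h₂ h₃)

lemma mk_rotate_distinguished (hT : Triangle.mk a b c ∈ distTriang C) :
    Triangle.mk b c (-a⟦(1 : ℤ)⟧') ∈ distTriang C :=
  rot_of_distTriang _ hT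

lemma mk_exists_hom₃ (hT : Triangle.mk a b c ∈ distTriang C)
    (hT' : Triangle.mk a' b' c' ∈ distTriang C) (f : A ⟶ A') (g : B ⟶ B')
    (comm : a ≫ g = f ≫ a') :
    ∃ k : D ⟶ D', b ≫ k = g ≫ b' ∧ c ≫ f⟦(1 : ℤ)⟧' = k ≫ c' :=
  complete_distinguished_triangle_morphism _ _ hT hT' f g comm

lemma mk_coyoneda_exact₁ (hT : Triangle.mk a b c ∈ distTriang C) {W : C} (f : W ⟶ A⟦(1 : ℤ)⟧)
    (hf : f ≫ a⟦(1 : ℤ)⟧' = 0) : ∃ g : W ⟶ D, f = g ≫ c :=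
  Triangle.coyoneda_exact₁ _ hT f hf

lemma mk_coyoneda_exact₃ (hT : Triangle.mk a b c ∈ distTriang C) {W : C} (f : W ⟶ D)
    (hf : f ≫ c = 0) : ∃ g : W ⟶ B, f = g ≫ b :=
  Triangle.coyoneda_exact₃ _ hT f hf

lemma mk_yoneda_exact₃ (hT : Triangle.mk a b c ∈ distTriang C) {W : C} (f : D ⟶ W)
    (hf : b ≫ f = 0) : ∃ g : A⟦(1 : ℤ)⟧ ⟶ W, f = c ≫ g :=
  Triangle.yoneda_exact₃ _ hT f hf

end MkForms

lemma mapBiprod_inv_map_fst (n : ℤ) (A B : C) :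
    ((shiftFunctor C n).mapBiprod A B).inv ≫ (biprod.fst : A ⊞ B ⟶ A)⟦n⟧' = biprod.fst := by
  rw [Iso.inv_comp_eq, Functor.mapBiprod_hom, biprod.lift_fst]

lemma mapBiprod_inv_map_snd (n : ℤ) (A B : C) :
    ((shiftFunctor C n).mapBiprod A B).inv ≫ (biprod.snd : A ⊞ B ⟶ B)⟦n⟧' = biprod.snd := by
  rw [Iso.inv_comp_eq, Functor.mapBiprod_hom, biprod.lift_snd]

section

variable {A B D A' B' D' : C} (a : A ⟶ B) (b : B ⟶ D) (c : D ⟶ A⟦(1 : ℤ)⟧)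
  (a' : A' ⟶ B') (b' : B' ⟶ D') (c' : D' ⟶ A'⟦(1 : ℤ)⟧)

/-- The direct sum of two triangles. -/
noncomputable def biprodTriangle : Triangle C :=
  Triangle.mk (biprod.map a a') (biprod.map b b')
    (biprod.map c c' ≫ ((shiftFunctor C (1 : ℤ)).mapBiprod A A').inv)

/-- The first projection from the direct sum of two triangles. -/
noncomputable def biprodTriangleFst : biprodTriangle a b c a' b' c' ⟶ Triangle.mk a b c :=
  Triangle.homMk _ _ (biprod.fst : A ⊞ A' ⟶ A) (biprod.fst : B ⊞ B' ⟶ B)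
    (biprod.fst : D ⊞ D' ⟶ D) (biprod.map_fst _ _) (biprod.map_fst _ _) (by
      change (biprod.map c c' ≫ ((shiftFunctor C (1 : ℤ)).mapBiprod A A').inv) ≫
        (biprod.fst : A ⊞ A' ⟶ A)⟦(1 : ℤ)⟧' = biprod.fst ≫ c
      rw [assoc, mapBiprod_inv_map_fst, biprod.map_fst])

/-- The second projection from the direct sum of two triangles. -/
noncomputable def biprodTriangleSnd : biprodTriangle a b c a' b' c' ⟶ Triangle.mk a' b' c' :=
  Triangle.homMk _ _ (biprod.snd : A ⊞ A' ⟶ A') (biprod.snd : B ⊞ B' ⟶ B')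
    (biprod.snd : D ⊞ D' ⟶ D') (biprod.map_snd _ _) (biprod.map_snd _ _) (by
      change (biprod.map c c' ≫ ((shiftFunctor C (1 : ℤ)).mapBiprod A A').inv) ≫
        (biprod.snd : A ⊞ A' ⟶ A')⟦(1 : ℤ)⟧' = biprod.snd ≫ c'
      rw [assoc, mapBiprod_inv_map_snd, biprod.map_snd])

end

lemma isIso_piLift_biprod (F : WalkingPair → C) [HasProduct F]
    (p : ∀ j, F .left ⊞ F .right ⟶ F j) (hl : p .left = biprod.fst) (hr : p .right = biprod.snd) :
    IsIso (Pi.lift p) := by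
  refine ⟨biprod.lift (Pi.π F .left) (Pi.π F .right), ?_, ?_⟩
  · apply biprod.hom_ext <;> simp [hl, hr]
  · apply Pi.hom_ext
    rintro (_ | _) <;> simp [hl, hr]

lemma biprodTriangle_distinguished {A B D A' B' D' : C} {a : A ⟶ B} {b : B ⟶ D}
    {c : D ⟶ A⟦(1 : ℤ)⟧} {a' : A' ⟶ B'} {b' : B' ⟶ D'} {c' : D' ⟶ A'⟦(1 : ℤ)⟧}
    (h : Triangle.mk a b c ∈ distTriang C) (h' : Triangle.mk a' b' c' ∈ distTriang C) :
    Triangle.mk (biprod.map a a') (biprod.map b b')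
      (biprod.map c c' ≫ ((shiftFunctor C (1 : ℤ)).mapBiprod A A').inv) ∈ distTriang C := by
  let T : WalkingPair → Triangle C := fun j =>
    WalkingPair.casesOn j (Triangle.mk a b c) (Triangle.mk a' b' c')
  let p : ∀ j, biprodTriangle a b c a' b' c' ⟶ T j := fun j =>
    WalkingPair.casesOn j (biprodTriangleFst a b c a' b' c') (biprodTriangleSnd a b c a' b' c')
  have hT : productTriangle T ∈ distTriang C :=
    productTriangle_distinguished T (by rintro (_ | _) <;> assumption)
  have hp : IsIso (productTriangle.lift T p) := Triangle.isIso_of_isIsos _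
    (isIso_piLift_biprod (fun j => (T j).obj₁) (fun j => (p j).hom₁) rfl rfl)
    (isIso_piLift_biprod (fun j => (T j).obj₂) (fun j => (p j).hom₂) rfl rfl)
    (isIso_piLift_biprod (fun j => (T j).obj₃) (fun j => (p j).hom₃) rfl rfl)
  exact isomorphic_distinguished _ hT _ (@asIso _ _ _ _ _ hp)

/-- A distinguished triangle with zero first morphism splits. -/
lemma exists_splitting_of_mor₁_eq_zero {A B D : C} {p : B ⟶ D} {q : D ⟶ A⟦(1 : ℤ)⟧}
    (hT : Triangle.mk (0 : A ⟶ B) p q ∈ distTriang C) :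
    ∃ (r : D ⟶ B) (s : A⟦(1 : ℤ)⟧ ⟶ D), p ≫ r = 𝟙 B ∧ s ≫ q = 𝟙 _ ∧
      q ≫ s + r ≫ p = 𝟙 D := by
  obtain ⟨s, hs⟩ := mk_coyoneda_exact₁ hT (𝟙 (A⟦(1 : ℤ)⟧)) (by simp)
  have hpq : p ≫ q = 0 := comp_distTriang_mor_zero₂₃ _ hT
  obtain ⟨r, hr⟩ := mk_coyoneda_exact₃ hT (𝟙 D - q ≫ s) (by
    rw [Preadditive.sub_comp, id_comp, assoc, ← hs, comp_id, sub_self])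
  have : Mono p := Triangle.mono₂ _ hT rfl
  refine ⟨r, s, ?_, hs.symm, by rw [← hr]; abel⟩
  rw [← cancel_mono p, assoc, ← hr]
  simp [reassoc_of% hpq]

lemma isGood_zero_zero_iff {X Y Z X' Y' Z' : C}
    {u : X ⟶ Y} {v : Y ⟶ Z} {w : Z ⟶ X⟦(1 : ℤ)⟧}
    {u' : X' ⟶ Y'} {v' : Y' ⟶ Z'} {w' : Z' ⟶ X'⟦(1 : ℤ)⟧}
    (hT : Triangle.mk u v w ∈ distTriang C)
    (hT' : Triangle.mk u' v' w' ∈ distTriang C) (h : Z ⟶ Z') :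
    IsGood (Triangle.mk u v w) (Triangle.mk u' v' w') 0 0 h ↔
      ∃ φ : X⟦(1 : ℤ)⟧ ⟶ Z', w ≫ φ = h ∧ φ ≫ w' = 0 := by
  have hR : Triangle.mk (-v) (-w) (-u⟦(1 : ℤ)⟧') ∈ distTriang C := by
    refine mk_distinguished_of_iso (mk_rotate_distinguished hT) (-Iso.refl _) (Iso.refl _)
      (-Iso.refl _) ?_ ?_ ?_ <;> simp
  have hS := biprodTriangle_distinguished hT' hR
  have hcone : IsGood (Triangle.mk u v w) (Triangle.mk u' v' w') 0 0 h ↔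
      Triangle.mk (biprod.map u' (-v))
        (biprod.desc (biprod.lift v' 0) (biprod.lift h (-w)) :
          Y' ⊞ Z ⟶ Z' ⊞ X⟦(1 : ℤ)⟧)
        (biprod.map w' (-u⟦(1 : ℤ)⟧') ≫
          ((shiftFunctor C (1 : ℤ)).mapBiprod X' Y).inv) ∈ distTriang C := by
    have e₁ : biprod.desc (biprod.lift u' 0) (biprod.lift 0 (-v)) = biprod.map u' (-v) := by
      ext <;> simp
    have e₂ : biprod.desc (biprod.lift w' 0)
        (biprod.lift ((0 : X ⟶ X')⟦(1 : ℤ)⟧') (-u⟦(1 : ℤ)⟧')) =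
          biprod.map w' (-u⟦(1 : ℤ)⟧') := by
      ext <;> simp
    rw [← e₁, ← e₂]
    rfl
  rw [hcone]
  constructor
  · intro hg
    obtain ⟨k, hk₂, hk₃⟩ := mk_exists_hom₃ hS hg (𝟙 _) (𝟙 _) (by simp)
    rw [CategoryTheory.Functor.map_id, comp_id, ← assoc, cancel_mono] at hk₃
    refine ⟨-(biprod.inr ≫ k ≫ biprod.fst), ?_, ?_⟩
    · have := biprod.inr ≫= hk₂ =≫ biprod.fst
      simpa using this
    · have := biprod.inr ≫= hk₃ =≫ biprod.fst
      simpa using this.symm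
  · rintro ⟨φ, rfl, hφ⟩
    let σ : Z' ⊞ X⟦(1 : ℤ)⟧ ≅ Z' ⊞ X⟦(1 : ℤ)⟧ :=
      { hom := biprod.desc biprod.inl (biprod.lift φ (𝟙 _))
        inv := biprod.desc biprod.inl (biprod.lift (-φ) (𝟙 _))
        hom_inv_id := by ext <;> simp
        inv_hom_id := by ext <;> simp }
    refine mk_distinguished_of_iso hS (Iso.refl _) (Iso.refl _) σ (by simp) ?_ ?_
    · ext <;> simp [σ]
    · rw [Iso.refl_hom, CategoryTheory.Functor.map_id, comp_id, ← assoc]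
      congr 1
      ext <;> simp [σ, hφ]

lemma IsVerdierGood.isMiddlingGood {T T' : Triangle C} {f : T.obj₁ ⟶ T'.obj₁}
    {g : T.obj₂ ⟶ T'.obj₂} {h : T.obj₃ ⟶ T'.obj₃} (hV : IsVerdierGood T T' f g h) :
    IsMiddlingGood T T' f g h := by
  obtain ⟨A, Y'', X'', vt, wt, g', g'', f', f'', α₁, β₁, α₂, β₂, -, hg, hf,
    ⟨o₁, o₂, o₃, o₄, o₅⟩, ⟨q₁, q₂, q₃, q₄, q₅⟩, rfl⟩ := hV
  obtain ⟨Z'', h', h'', hh⟩ := distinguished_cocone_triangle (α₁ ≫ β₂)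
  let O := Triangulated.someOctahedron rfl o₅ (mk_rotate_distinguished q₅) hh
  obtain ⟨m, n, e₁, e₂, e₃, e₄, hO⟩ := O
  refine ⟨X'', Y'', Z'', f', f'', g', g'', h', h'', α₂ ≫ β₁, m, n, hf, hg, hh, ?_,
    ?_, ?_, ?_, ?_, ?_, ?_⟩
  · rw [rotate_distinguished_triangle]
    change Triangle.mk m n (-(α₂ ≫ β₁)⟦(1 : ℤ)⟧') ∈ distTriang C
    rwa [Functor.map_comp, ← Preadditive.neg_comp]
  · rw [← o₃, ← reassoc_of% q₁]
  · rw [← q₃, ← o₃, assoc, assoc, e₁]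
  · exact e₃.symm
  · rw [assoc, o₄, reassoc_of% q₂]
  · exact e₂
  · rw [← o₂, Functor.map_comp, reassoc_of% e₄, ← q₂, Functor.map_comp]
    simp

lemma IsMiddlingGood.exists_lightning_flash {X Y Z X' Y' Z' : C}
    {u : X ⟶ Y} {v : Y ⟶ Z} {w : Z ⟶ X⟦(1 : ℤ)⟧}
    {u' : X' ⟶ Y'} {v' : Y' ⟶ Z'} {w' : Z' ⟶ X'⟦(1 : ℤ)⟧}
    (hT : Triangle.mk u v w ∈ distTriang C)
    (hT' : Triangle.mk u' v' w' ∈ distTriang C) {h : Z ⟶ Z'} (hvh : v ≫ h = 0)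
    (hM : IsMiddlingGood (Triangle.mk u v w) (Triangle.mk u' v' w') 0 0 h) :
    ∃ θ : X⟦(1 : ℤ)⟧ ⟶ Y', h = w ≫ θ ≫ v' := by
  obtain ⟨X'', Y'', Z'', f', f'', g', g'', h', h'', u'', v'', w'', hf, hg, hh, hT'',
    c₁, c₂, c₃, c₄, c₅, c₆⟩ : ∃ (X'' Y'' Z'' : C)
      (f' : X' ⟶ X'') (f'' : X'' ⟶ X⟦(1 : ℤ)⟧) (g' : Y' ⟶ Y'') (g'' : Y'' ⟶ Y⟦(1 : ℤ)⟧)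
      (h' : Z' ⟶ Z'') (h'' : Z'' ⟶ Z⟦(1 : ℤ)⟧)
      (u'' : X'' ⟶ Y'') (v'' : Y'' ⟶ Z'') (w'' : Z'' ⟶ X''⟦(1 : ℤ)⟧),
      Triangle.mk (0 : X ⟶ X') f' f'' ∈ distTriang C ∧
      Triangle.mk (0 : Y ⟶ Y') g' g'' ∈ distTriang C ∧
      Triangle.mk h h' h'' ∈ distTriang C ∧ Triangle.mk u'' v'' w'' ∈ distTriang C ∧
      u' ≫ g' = f' ≫ u'' ∧ v' ≫ h' = g' ≫ v'' ∧ w' ≫ f'⟦(1 : ℤ)⟧' = h' ≫ w'' ∧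
      u'' ≫ g'' = f'' ≫ u⟦(1 : ℤ)⟧' ∧ v'' ≫ h'' = g'' ≫ v⟦(1 : ℤ)⟧' ∧
      h'' ≫ w⟦(1 : ℤ)⟧' = -(w'' ≫ f''⟦(1 : ℤ)⟧') := hM
  obtain ⟨r, s, hr, hs, hrs⟩ := exists_splitting_of_mor₁_eq_zero hf
  obtain ⟨q, -, hq, -, -⟩ := exists_splitting_of_mor₁_eq_zero hg
  have hwu : w ≫ u⟦(1 : ℤ)⟧' = 0 := comp_distTriang_mor_zero₃₁ _ hT
  have hvw : v ≫ w = 0 := comp_distTriang_mor_zero₂₃ _ hT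
  have hwu'' : w'' ≫ u''⟦(1 : ℤ)⟧' = 0 := comp_distTriang_mor_zero₃₁ _ hT''
  obtain ⟨θ₀, hθ₀⟩ := mk_coyoneda_exact₃ hg (w ≫ s ≫ u'') (by
    rw [assoc, assoc, c₄, reassoc_of% hs, hwu])
  have hsf : f'' ≫ s = 𝟙 _ - r ≫ f' := by rw [← hrs]; abel
  have key : h'' ≫ θ₀⟦(1 : ℤ)⟧' = w'' ≫ r⟦(1 : ℤ)⟧' ≫ u'⟦(1 : ℤ)⟧' := by
    have : (h'' ≫ θ₀⟦(1 : ℤ)⟧') ≫ g'⟦(1 : ℤ)⟧' =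
        (w'' ≫ r⟦(1 : ℤ)⟧' ≫ u'⟦(1 : ℤ)⟧') ≫ g'⟦(1 : ℤ)⟧' := by
      simp only [assoc, ← Functor.map_comp]
      rw [← hθ₀, c₁, Functor.map_comp, reassoc_of% c₆, Preadditive.neg_comp, assoc,
        ← Functor.map_comp, reassoc_of% hsf]
      simp [Preadditive.sub_comp, Preadditive.comp_sub, hwu'']
    have h2 := this =≫ q⟦(1 : ℤ)⟧'
    simpa only [assoc, ← Functor.map_comp, hq, comp_id] using h2
  obtain ⟨c, hc₂, hc₃⟩ := mk_exists_hom₃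
    (mk_rotate_distinguished (mk_rotate_distinguished hh))
    (mk_rotate_distinguished (mk_rotate_distinguished (mk_rotate_distinguished hT')))
    (w'' ≫ r⟦(1 : ℤ)⟧') (-θ₀⟦(1 : ℤ)⟧') (by simp [key])
  obtain ⟨e, rfl⟩ := (shiftFunctor C (1 : ℤ)).map_surjective c
  have he₂ : h ≫ e = -(θ₀ ≫ v') := (shiftFunctor C (1 : ℤ)).map_injective (by
    simp at hc₂ ⊢
    rw [← hc₂]; simp)
  have he₃ : e ≫ w' = w' := (shiftFunctor C (1 : ℤ)).map_injective (by
    have h1 : h' ≫ w'' ≫ r⟦(1 : ℤ)⟧' = w' := by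
      rw [← reassoc_of% c₃, ← Functor.map_comp, hr]; simp
    simp only [Functor.map_comp, Preadditive.neg_comp, Preadditive.comp_neg, neg_inj] at hc₃
    rw [Functor.map_comp, ← hc₃, ← Functor.map_comp, ← Functor.map_comp, h1])
  obtain ⟨m, hm⟩ := mk_coyoneda_exact₃ hT' (e - 𝟙 _) (by simp [he₃])
  have hvθ₀ : v ≫ θ₀ = 0 := by
    have h2 : (v ≫ θ₀) ≫ g' ≫ q = 0 := by
      rw [assoc, ← reassoc_of% hθ₀, reassoc_of% hvw, zero_comp]
    simpa [hq] using h2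
  obtain ⟨θ, hθ⟩ := mk_yoneda_exact₃ hT (-(θ₀ + h ≫ m)) (by
    simp [hvθ₀, reassoc_of% hvh])
  refine ⟨θ, ?_⟩
  rw [← reassoc_of% hθ]
  simp only [Preadditive.neg_comp, Preadditive.add_comp, assoc, ← hm, Preadditive.comp_sub, he₂]
  simp

/-- Verdier goodness is stable under adding a lightning flash. -/
lemma IsVerdierGood.add_lightning_flash {T T' : Triangle C} {f : T.obj₁ ⟶ T'.obj₁}
    {g : T.obj₂ ⟶ T'.obj₂} {h : T.obj₃ ⟶ T'.obj₃} (hV : IsVerdierGood T T' f g h)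
    (τ : T.obj₁⟦(1 : ℤ)⟧ ⟶ T'.obj₂) :
    IsVerdierGood T T' f g (h + T.mor₃ ≫ τ ≫ T'.mor₂) := by
  obtain ⟨A, Y'', X'', vt, wt, g', g'', f', f'', α₁, β₁, α₂, β₂, hA, hg, hf,
    ⟨o₁, o₂, o₃, o₄, o₅⟩, hO, rfl⟩ := hV
  have hvw : vt ≫ wt = 0 := comp_distTriang_mor_zero₂₃ _ hA
  let σ : A ≅ A := ⟨𝟙 A + wt ≫ τ ≫ vt, 𝟙 A - wt ≫ τ ≫ vt,
    by simp [reassoc_of% hvw], by simp [reassoc_of% hvw]⟩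
  have hσ₁ : vt ≫ σ.hom = vt := by simp [σ, reassoc_of% hvw]
  have hσ₂ : σ.hom ≫ wt = wt := by simp [σ, hvw]
  have hσ₃ : vt ≫ σ.inv = vt := by rw [Iso.comp_inv_eq, hσ₁]
  have hσ₄ : σ.inv ≫ wt = wt := by rw [Iso.inv_comp_eq, hσ₂]
  refine ⟨A, Y'', X'', vt, wt, g', g'', f', f'', α₁ ≫ σ.hom, σ.inv ≫ β₁, α₂, β₂, hA, hg, hf,
    ⟨?_, ?_, ?_, ?_, ?_⟩, hO, ?_⟩
  · rw [reassoc_of% o₁, hσ₁]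
  · rw [assoc, hσ₂, o₂]
  · rw [reassoc_of% hσ₃, o₃]
  · rw [assoc, o₄, reassoc_of% hσ₄]
  · exact mk_distinguished_of_iso o₅ (Iso.refl _) σ.symm (Iso.refl _) (by simp) (by simp) (by simp)
  · simp [σ, reassoc_of% o₂, hO.2.2.1]

/-- Every commutative square extends to a Verdier good morphism of triangles. -/
lemma exists_isVerdierGood {T T' : Triangle C} (hT : T ∈ distTriang C) (hT' : T' ∈ distTriang C)
    {f : T.obj₁ ⟶ T'.obj₁} {g : T.obj₂ ⟶ T'.obj₂} (comm : T.mor₁ ≫ g = f ≫ T'.mor₁) :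
    ∃ h, IsVerdierGood T T' f g h ∧ T.mor₂ ≫ h = g ≫ T'.mor₂ := by
  obtain ⟨A, vt, wt, hA⟩ := distinguished_cocone_triangle (T.mor₁ ≫ g)
  obtain ⟨Y'', g', g'', hg⟩ := distinguished_cocone_triangle g
  obtain ⟨X'', f', f'', hf⟩ := distinguished_cocone_triangle f
  let O₁ := Triangulated.someOctahedron rfl hT hg hA
  let O₂ := Triangulated.someOctahedron comm.symm hf hT' hA
  refine ⟨_, ⟨A, Y'', X'', vt, wt, g', g'', f', f'', O₁.m₁, O₁.m₃, O₂.m₁, O₂.m₃, hA, hg, hf,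
    ⟨O₁.comm₁, O₁.comm₂, O₁.comm₃, O₁.comm₄.symm, O₁.mem⟩,
    ⟨O₂.comm₁, O₂.comm₂, O₂.comm₃, O₂.comm₄.symm, O₂.mem⟩, rfl⟩, ?_⟩
  rw [O₁.comm₁_assoc, O₂.comm₃]

theorem stmt_18 {X Y Z X' Y' Z' : C}
    (u : X ⟶ Y) (v : Y ⟶ Z) (w : Z ⟶ X⟦(1 : ℤ)⟧)
    (u' : X' ⟶ Y') (v' : Y' ⟶ Z') (w' : Z' ⟶ X'⟦(1 : ℤ)⟧)
    (hT : Triangle.mk u v w ∈ distTriang C)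
    (hT' : Triangle.mk u' v' w' ∈ distTriang C)
    (h : Z ⟶ Z')
    (hmap : IsTriMap (Triangle.mk u v w) (Triangle.mk u' v' w') 0 0 h) :
    (IsGood (Triangle.mk u v w) (Triangle.mk u' v' w') 0 0 h ↔ IsVerdierGood (Triangle.mk u v w) (Triangle.mk u' v' w') 0 0 h) ∧
    (IsVerdierGood (Triangle.mk u v w) (Triangle.mk u' v' w') 0 0 h ↔ IsMiddlingGood (Triangle.mk u v w) (Triangle.mk u' v' w') 0 0 h) ∧
    (IsMiddlingGood (Triangle.mk u v w) (Triangle.mk u' v' w') 0 0 h ↔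
      ∃ φ : X⟦(1 : ℤ)⟧ ⟶ Z', w ≫ φ = h ∧ φ ≫ w' = 0) ∧
    ((∃ φ : X⟦(1 : ℤ)⟧ ⟶ Z', w ≫ φ = h ∧ φ ≫ w' = 0) ↔
      ∃ θ : X⟦(1 : ℤ)⟧ ⟶ Y', h = w ≫ θ ≫ v') := by
  have hvh : v ≫ h = 0 := hmap.2.1.trans zero_comp
  have hde : (∃ φ : X⟦(1 : ℤ)⟧ ⟶ Z', w ≫ φ = h ∧ φ ≫ w' = 0) ↔
      ∃ θ : X⟦(1 : ℤ)⟧ ⟶ Y', h = w ≫ θ ≫ v' := by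
    constructor
    · rintro ⟨φ, rfl, hφ⟩
      obtain ⟨θ, rfl⟩ := mk_coyoneda_exact₃ hT' φ hφ
      exact ⟨θ, rfl⟩
    · rintro ⟨θ, rfl⟩
      have hvw' : v' ≫ w' = 0 := comp_distTriang_mor_zero₂₃ _ hT'
      exact ⟨θ ≫ v', rfl, by simp [hvw']⟩
  have hbc := IsVerdierGood.isMiddlingGood (T := Triangle.mk u v w) (T' := Triangle.mk u' v' w')
    (f := 0) (g := 0) (h := h)
  have hce := IsMiddlingGood.exists_lightning_flash hT hT' hvh
  have heb : (∃ θ : X⟦(1 : ℤ)⟧ ⟶ Y', h = w ≫ θ ≫ v') →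
      IsVerdierGood (Triangle.mk u v w) (Triangle.mk u' v' w') 0 0 h := by
    rintro ⟨θ, rfl⟩
    obtain ⟨(h₀ : Z ⟶ Z'), hV, hvh₀⟩ := exists_isVerdierGood hT hT' (f := 0) (g := 0)
      (comp_zero.trans zero_comp.symm)
    obtain ⟨θ₀, hθ₀⟩ := hV.isMiddlingGood.exists_lightning_flash hT hT' (hvh₀.trans zero_comp)
    have hθ : h₀ + w ≫ (θ - θ₀) ≫ v' = w ≫ θ ≫ v' := by
      rw [hθ₀]
      simp [Preadditive.sub_comp, Preadditive.comp_sub]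
    rw [← hθ]
    exact hV.add_lightning_flash (θ - θ₀)
  have had := isGood_zero_zero_iff hT hT' h
  exact ⟨had.trans (hde.trans ⟨heb, fun hb => hce (hbc hb)⟩), ⟨hbc, fun hc => heb (hce hc)⟩,
    ⟨fun hc => hde.2 (hce hc), fun hd => hbc (heb (hde.1 hd))⟩, hde⟩
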